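/- Define a_0 = 20, a_j = 2^{a_{j−1}} for j ≥ 1, and E_j = (a_j)². Define ℓ_j = 4E_jE_{j−2}/E_{j−1}, b_j = E_j/E_{j−1} for j ≥ 2, ℓ_1 = E_1, and L_j = ℓ_j + ∑_{k=1}^{j−1} b_j ⋯ b_{k+1} ℓ_k (L_1 = ℓ_1). Let (W_j)_{j≥1} be a sequence of real numbers with W_j ≥ 1 satisfying W_j ≤ (W_{j−1})^{b_j} · (L_j)^{ℓ_j} for all j ≥ 2. Then there exists a constant C > 1 such that W_j ≤ C^{L_j} for every j ≥ 1. -/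

import Mathlib

/-- The sequence `a_0 = 20`, `a_j = 2^{a_{j-1}}`. -/
def a : ℕ → ℕ
  | 0 => 20
  | j + 1 => 2 ^ a j

/-- `E_j = (a_j)²`. -/
def E (j : ℕ) : ℕ := a j ^ 2

/-- `ℓ_1 = E_1` and `ℓ_j = 4 E_j E_{j-2} / E_{j-1}` for `j ≥ 2`, as reals. -/
noncomputable def ell (j : ℕ) : ℝ :=
  if j = 1 then (E 1 : ℝ) else 4 * (E j : ℝ) * (E (j - 2) : ℝ) / (E (j - 1) : ℝ)

/-- `b_j = E_j / E_{j-1}`, as a real. -/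
noncomputable def b (j : ℕ) : ℝ := (E j : ℝ) / (E (j - 1) : ℝ)

/-- `L_j = ℓ_j + ∑_{k=1}^{j-1} b_j b_{j-1} ⋯ b_{k+1} ℓ_k` (so `L_1 = ℓ_1`). -/
noncomputable def Lb (j : ℕ) : ℝ :=
  ell j + ∑ k ∈ Finset.Icc 1 (j - 1), (∏ i ∈ Finset.Icc (k + 1) j, b i) * ell k

theorem a_succ (j : ℕ) : a (j + 1) = 2 ^ a j := rfl

theorem cube_mul_le_two_pow {n : ℕ} (hn : 20 ≤ n) : 24 * n ^ 3 ≤ 2 ^ n := by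
  induction n, hn using Nat.le_induction with
  | base => norm_num
  | succ n hn ih =>
    have h : (n + 1) ^ 3 ≤ 2 * n ^ 3 := by nlinarith [Nat.mul_le_mul hn hn]
    rw [pow_succ 2 n]
    omega

theorem twenty_le_a (j : ℕ) : 20 ≤ a j := by
  induction j with
  | zero => exact le_rfl
  | succ j ih => exact ih.trans Nat.lt_two_pow_self.le

theorem a_pos (j : ℕ) : (0 : ℝ) < a j := by
  exact_mod_cast lt_of_lt_of_le (by norm_num) (twenty_le_a j)

theorem cast_E (j : ℕ) : (E j : ℝ) = (a j : ℝ) ^ 2 := by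
  rw [E, Nat.cast_pow]

theorem E_pos (j : ℕ) : (0 : ℝ) < E j := by
  rw [cast_E]
  exact pow_pos (a_pos j) 2

/-- The reciprocals `1 / a_j` decrease fast enough to control the error terms by telescoping. -/
theorem sq_div_le_inv_sub_inv (j : ℕ) :
    12 * (a j : ℝ) ^ 2 / a (j + 1) ≤ 1 / a j - 1 / a (j + 1) := by
  have hn : (20 : ℝ) ≤ a j := by exact_mod_cast twenty_le_a j
  have hN : 24 * (a j : ℝ) ^ 3 ≤ a (j + 1) := by
    rw [a_succ]
    exact_mod_cast cube_mul_le_two_pow (twenty_le_a j)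
  have hn0 := a_pos j
  have hN0 := a_pos (j + 1)
  rw [div_sub_div _ _ hn0.ne' hN0.ne', div_le_div_iff₀ hN0 (mul_pos hn0 hN0)]
  have h : 12 * (a j : ℝ) ^ 3 + a j ≤ a (j + 1) := by
    have : (a j : ℝ) * 1 ≤ a j * (a j) ^ 2 :=
      mul_le_mul_of_nonneg_left (by nlinarith) hn0.le
    nlinarith
  nlinarith [mul_le_mul_of_nonneg_right h hN0.le]

theorem ell_add_two (j : ℕ) : ell (j + 2) = E (j + 2) * (4 * E j / E (j + 1)) := by
  rw [ell, if_neg (by omega), Nat.add_sub_cancel, show j + 2 - 1 = j + 1 from rfl]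
  ring

theorem b_succ (j : ℕ) : b (j + 1) = E (j + 1) / E j := rfl

theorem Lb_one : Lb 1 = E 1 := by
  simp [Lb, ell]

theorem Lb_add_two (j : ℕ) : Lb (j + 2) = ell (j + 2) + b (j + 2) * Lb (j + 1) := by
  rw [Lb, Lb, show j + 2 - 1 = j + 1 from rfl, Nat.add_sub_cancel,
    Finset.sum_Icc_succ_top (by omega), mul_add, Finset.mul_sum]
  have h : ∑ k ∈ Finset.Icc 1 j, (∏ i ∈ Finset.Icc (k + 1) (j + 2), b i) * ell k =
      ∑ k ∈ Finset.Icc 1 j, b (j + 2) * ((∏ i ∈ Finset.Icc (k + 1) (j + 1), b i) * ell k) := by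
    refine Finset.sum_congr rfl fun k hk => ?_
    rw [Finset.mem_Icc] at hk
    rw [Finset.prod_Icc_succ_top (by omega)]
    ring
  rw [h, Finset.Icc_self, Finset.prod_singleton]
  ring

theorem E_le_Lb (j : ℕ) : (E (j + 1) : ℝ) ≤ Lb (j + 1) := by
  induction j with
  | zero => exact Lb_one.ge
  | succ j ih =>
    have h0 := E_pos j
    have h1 := E_pos (j + 1)
    have h2 := E_pos (j + 2)
    have hb : b (j + 2) * E (j + 1) = E (j + 2) := by
      rw [b_succ]
      exact div_mul_cancel₀ _ h1.ne'
    have hb0 : 0 ≤ b (j + 2) := by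
      rw [b_succ]
      positivity
    have hl : 0 ≤ ell (j + 2) := by
      rw [ell_add_two]
      positivity
    rw [Lb_add_two]
    linarith [mul_le_mul_of_nonneg_left ih hb0]

theorem Lb_le (j : ℕ) : Lb (j + 1) ≤ E (j + 1) * (2 - 1 / a j) := by
  induction j with
  | zero =>
    rw [Lb_one]
    have h : (1 : ℝ) / a 0 ≤ 1 := by norm_num [a]
    nlinarith [E_pos 1]
  | succ j ih =>
    have h1 := E_pos (j + 1)
    have h2 := E_pos (j + 2)
    have hN : (1 : ℝ) ≤ a (j + 1) := by
      exact_mod_cast le_trans (by norm_num) (twenty_le_a (j + 1))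
    have hb0 : 0 ≤ b (j + 2) := by
      rw [b_succ]
      positivity
    have hb : b (j + 2) * (E (j + 1) * (2 - 1 / a j)) = E (j + 2) * (2 - 1 / a j) := by
      rw [b_succ, ← mul_assoc, div_mul_cancel₀ _ h1.ne']
    have hs : 4 * (E j : ℝ) / E (j + 1) ≤ 1 / a j - 1 / a (j + 1) := by
      refine le_trans ?_ (sq_div_le_inv_sub_inv j)
      rw [cast_E, cast_E]
      gcongr
      · norm_num
      · exact le_self_pow₀ hN two_ne_zero
    rw [Lb_add_two, ell_add_two]
    nlinarith [mul_le_mul_of_nonneg_left ih hb0, mul_le_mul_of_nonneg_left hs h2.le]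

theorem log_Lb_le (j : ℕ) : Real.log (Lb (j + 2)) ≤ 3 * a (j + 1) := by
  have hE := E_pos (j + 2)
  have hL : Lb (j + 2) ≤ 2 * E (j + 2) := by
    have h : 0 ≤ (E (j + 2) : ℝ) * (1 / a (j + 1)) := by positivity
    linarith [Lb_le (j + 1)]
  have hlog : Real.log (2 * E (j + 2)) = (1 + 2 * a (j + 1)) * Real.log 2 := by
    rw [Real.log_mul two_ne_zero hE.ne', cast_E, a_succ (j + 1), Nat.cast_pow, Nat.cast_ofNat,
      Real.log_pow, Real.log_pow, Nat.cast_ofNat]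
    ring
  have hN : (1 : ℝ) ≤ a (j + 1) := by
    exact_mod_cast le_trans (by norm_num) (twenty_le_a (j + 1))
  have h2 : Real.log 2 ≤ 1 := by linarith [Real.log_two_lt_d9]
  calc Real.log (Lb (j + 2)) ≤ Real.log (2 * E (j + 2)) :=
        Real.log_le_log (hE.trans_le (E_le_Lb (j + 1))) hL
    _ = (1 + 2 * a (j + 1)) * Real.log 2 := hlog
    _ ≤ (1 + 2 * a (j + 1)) * 1 := by gcongr
    _ ≤ 3 * a (j + 1) := by linarith

theorem log_weight_le (W : ℕ → ℝ) (hW1 : ∀ j : ℕ, 1 ≤ j → 1 ≤ W j)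
    (hrec : ∀ j : ℕ, 2 ≤ j → W j ≤ W (j - 1) ^ b j * Lb j ^ ell j) (j : ℕ) :
    Real.log (W (j + 1)) ≤ E (j + 1) * (Real.log (W 1) / E 1 + 1 - 1 / a j) := by
  induction j with
  | zero =>
    have h1 := E_pos 1
    have h : (1 : ℝ) / a 0 ≤ 1 := by norm_num [a]
    have hc : (E 1 : ℝ) * (Real.log (W 1) / E 1) = Real.log (W 1) := mul_div_cancel₀ _ h1.ne'
    nlinarith
  | succ j ih =>
    have h1 := E_pos (j + 1)
    have h2 := E_pos (j + 2)
    have hb0 : 0 ≤ b (j + 2) := by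
      rw [b_succ]
      positivity
    have hl0 : 0 ≤ ell (j + 2) := by
      rw [ell_add_two]
      positivity
    have hW : 0 < W (j + 1) := one_pos.trans_le (hW1 _ (by omega))
    have hW' : 0 < W (j + 2) := one_pos.trans_le (hW1 _ (by omega))
    have hL : 0 < Lb (j + 2) := h2.trans_le (E_le_Lb (j + 1))
    have hlog : Real.log (W (j + 2)) ≤
        b (j + 2) * Real.log (W (j + 1)) + ell (j + 2) * Real.log (Lb (j + 2)) := by
      have h := Real.log_le_log hW' (hrec (j + 2) (by omega))
      rwa [show j + 2 - 1 = j + 1 from rfl,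
        Real.log_mul (Real.rpow_pos_of_pos hW _).ne' (Real.rpow_pos_of_pos hL _).ne',
        Real.log_rpow hW, Real.log_rpow hL] at h
    have hb : ∀ x : ℝ, b (j + 2) * (E (j + 1) * x) = E (j + 2) * x := fun x => by
      rw [b_succ, ← mul_assoc, div_mul_cancel₀ _ h1.ne']
    have he : ell (j + 2) * (3 * a (j + 1)) = E (j + 2) * (12 * (a j : ℝ) ^ 2 / a (j + 1)) := by
      have hN := (a_pos (j + 1)).ne'
      rw [ell_add_two, cast_E j, cast_E (j + 1)]
      field_simp
      ring
    have hI := mul_le_mul_of_nonneg_left ih hb0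
    rw [hb] at hI
    have hll := mul_le_mul_of_nonneg_left (log_Lb_le j) hl0
    rw [he] at hll
    linarith [mul_le_mul_of_nonneg_left (sq_div_le_inv_sub_inv j) h2.le]

/-- If `(W_j)` satisfies `W_j ≥ 1` and the recursion
`W_j ≤ (W_{j-1})^{b_j} (L_j)^{ℓ_j}` for `j ≥ 2`, then there exists a constant
`C > 1` such that `W_j ≤ C^{L_j}` for every `j ≥ 1`. -/
theorem weight_exponential_bound (W : ℕ → ℝ)
    (hW1 : ∀ j : ℕ, 1 ≤ j → 1 ≤ W j)
    (hrec : ∀ j : ℕ, 2 ≤ j → W j ≤ W (j - 1) ^ b j * Lb j ^ ell j) :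
    ∃ C : ℝ, 1 < C ∧ ∀ j : ℕ, 1 ≤ j → W j ≤ C ^ Lb j := by
  have hK : 0 < Real.log (W 1) / E 1 + 1 := by
    have := div_nonneg (Real.log_nonneg (hW1 1 le_rfl)) (E_pos 1).le
    linarith
  refine ⟨Real.exp (Real.log (W 1) / E 1 + 1), Real.one_lt_exp_iff.2 hK, fun j hj => ?_⟩
  obtain ⟨j, rfl⟩ := Nat.exists_eq_add_of_le' hj
  rw [← Real.exp_mul, ← Real.log_le_iff_le_exp (one_pos.trans_le (hW1 _ hj))]
  have h : 0 ≤ (E (j + 1) : ℝ) * (1 / a j) := by positivity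
  linarith [log_weight_le W hW1 hrec j, mul_le_mul_of_nonneg_left (E_le_Lb j) hK.le]
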